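/- arXiv:1903.08338 — 12 statements merged into one kernel-verified Lean document; each statement's English description precedes it below -/
import Mathlib

section
/- Let u be a permutation in S_n (identified with its n×n permutation matrix) and let 1 ≤ i < j ≤ n. Then the following are equivalent: (1) (i,j) is an inversion of u, i.e. u(i) > u(j); (2) R_{i,j}^{u(j),u(i)} is an essential rectangle for the permutation matrix of u. -/
/-- An alternating sign matrix of size `n`, with entries indexed by `1..n`
(entries outside this range are irrelevant). -/
def IsASM (n : ℕ) (A : ℕ → ℕ → ℤ) : Prop :=
  (∀ i ∈ Finset.Icc 1 n, ∀ j ∈ Finset.Icc 1 n, A i j = -1 ∨ A i j = 0 ∨ A i j = 1) ∧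
  (∀ i ∈ Finset.Icc 1 n, ∀ j ∈ Finset.Icc 1 n,
      (∑ k ∈ Finset.Icc 1 j, A i k) = 0 ∨ (∑ k ∈ Finset.Icc 1 j, A i k) = 1) ∧
  (∀ i ∈ Finset.Icc 1 n, ∀ j ∈ Finset.Icc 1 n,
      (∑ k ∈ Finset.Icc 1 i, A k j) = 0 ∨ (∑ k ∈ Finset.Icc 1 i, A k j) = 1) ∧
  (∀ i ∈ Finset.Icc 1 n, (∑ k ∈ Finset.Icc 1 n, A i k) = 1) ∧
  (∀ j ∈ Finset.Icc 1 n, (∑ k ∈ Finset.Icc 1 n, A k j) = 1)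

/-- Corner sum matrix: `Ã(i,j) = Σ_{p ≤ i, q ≤ j} a_{pq}` (zero when `i = 0` or `j = 0`). -/
def cornerSum (A : ℕ → ℕ → ℤ) (i j : ℕ) : ℤ :=
  ∑ p ∈ Finset.Icc 1 i, ∑ q ∈ Finset.Icc 1 j, A p q

/-- `R_{ij}^{kl}` (for `1 ≤ i < j ≤ n`, `1 ≤ k < l ≤ n`) is an essential rectangle for `A`. -/
def EssRect (n : ℕ) (A : ℕ → ℕ → ℤ) (i j k l : ℕ) : Prop :=
  1 ≤ i ∧ i < j ∧ j ≤ n ∧ 1 ≤ k ∧ k < l ∧ l ≤ n ∧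
  ∀ p q, i ≤ p → p < j → k ≤ q → q < l →
    cornerSum A p k = cornerSum A p (k - 1) ∧
    cornerSum A p l = cornerSum A p (l - 1) + 1 ∧
    cornerSum A i q = cornerSum A (i - 1) q ∧
    cornerSum A j q = cornerSum A (j - 1) q + 1

/-- The bigrassmannian statistic `β(A) = Σ min(i,j) − Σ Ã(i,j)`. -/
def asmBeta (n : ℕ) (A : ℕ → ℕ → ℤ) : ℤ :=
  (∑ i ∈ Finset.Icc 1 n, ∑ j ∈ Finset.Icc 1 n, (min i j : ℤ)) -
    ∑ i ∈ Finset.Icc 1 n, ∑ j ∈ Finset.Icc 1 n, cornerSum A i j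

/-- ASM (Bruhat) order: `A ≤ B` iff `Ã(i,j) ≥ B̃(i,j)` for all `i, j`. -/
def ASMLE (n : ℕ) (A B : ℕ → ℕ → ℤ) : Prop :=
  ∀ i ∈ Finset.Icc 1 n, ∀ j ∈ Finset.Icc 1 n, cornerSum B i j ≤ cornerSum A i j

/-- The labelled ASM-graph edge relation `A →_{ij}^{kl} B`. -/
def ASMEdge (n : ℕ) (A B : ℕ → ℕ → ℤ) (i j k l : ℕ) : Prop :=
  EssRect n B i j k l ∧
  (∀ p q, i ≤ p → p < j → k ≤ q → q < l → cornerSum A p q = cornerSum B p q + 1) ∧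
  (∀ p q, p ≤ n → q ≤ n → ¬(i ≤ p ∧ p < j ∧ k ≤ q ∧ q < l) →
      cornerSum A p q = cornerSum B p q)

/-- The ASM-graph edge relation `A → B`. -/
def ASMEdgeRel (n : ℕ) (A B : ℕ → ℕ → ℤ) : Prop :=
  ∃ i j k l, ASMEdge n A B i j k l

/-- The `0/1` permutation matrix of a permutation of `ℕ`. -/
def PermMatrixZ (u : Equiv.Perm ℕ) : ℕ → ℕ → ℤ :=
  fun i j => if u i = j then 1 else 0

/-- A permutation (of `ℕ`, supported on `1..n`) is bigrassmannian: there is a unique pair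
`(i,j) ∈ [n-1]²` with `u⁻¹(i) > u⁻¹(i+1)` and `u(j) > u(j+1)`. -/
def IsBigrass (n : ℕ) (u : Equiv.Perm ℕ) : Prop :=
  ∃! p : ℕ × ℕ, (1 ≤ p.1 ∧ p.1 ≤ n - 1 ∧ 1 ≤ p.2 ∧ p.2 ≤ n - 1) ∧
    u.symm (p.1 + 1) < u.symm p.1 ∧ u (p.2 + 1) < u p.2

/-- The ASM Laurent monomial `x^A` evaluated at a real matrix `M`. -/
noncomputable def asmMon (n : ℕ) (A : ℕ → ℕ → ℤ) (M : ℕ → ℕ → ℝ) : ℝ :=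
  ∏ p ∈ Finset.Icc 1 n, ∏ q ∈ Finset.Icc 1 n, M p q ^ A p q

/-- A real matrix (indexed by `1..n`) is totally nonnegative: every minor is nonnegative. -/
def IsTNNReal (n : ℕ) (M : ℕ → ℕ → ℝ) : Prop :=
  ∀ (r : ℕ) (f g : Fin r → ℕ), StrictMono f → StrictMono g →
    (∀ a, f a ∈ Finset.Icc 1 n) → (∀ a, g a ∈ Finset.Icc 1 n) →
    0 ≤ (Matrix.of (fun a b => M (f a) (g b))).det
/-- Consecutive corner sums in a column direction differ by a partial row sum. -/
theorem cornerSum_row {A : ℕ → ℕ → ℤ} {i : ℕ} (hi : 1 ≤ i) (q : ℕ) :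
    cornerSum A i q = cornerSum A (i - 1) q + ∑ k ∈ Finset.Icc 1 q, A i k := by
  obtain ⟨m, rfl⟩ := Nat.exists_eq_add_of_le' hi
  simp only [cornerSum, Nat.add_sub_cancel]
  exact Finset.sum_Icc_succ_top (by omega) _

/-- Consecutive corner sums in a row direction differ by a partial column sum. -/
theorem cornerSum_col {A : ℕ → ℕ → ℤ} {k : ℕ} (hk : 1 ≤ k) (p : ℕ) :
    cornerSum A p k = cornerSum A p (k - 1) + ∑ r ∈ Finset.Icc 1 p, A r k := by
  obtain ⟨m, rfl⟩ := Nat.exists_eq_add_of_le' hk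
  simp only [cornerSum, Nat.add_sub_cancel, ← Finset.sum_add_distrib]
  exact Finset.sum_congr rfl fun _ _ => Finset.sum_Icc_succ_top (by omega) _

theorem sum_row_permMatrixZ (u : Equiv.Perm ℕ) (i q : ℕ) :
    ∑ k ∈ Finset.Icc 1 q, PermMatrixZ u i k = if u i ∈ Finset.Icc 1 q then 1 else 0 :=
  Finset.sum_ite_eq _ _ _

theorem sum_col_permMatrixZ (u : Equiv.Perm ℕ) (i p : ℕ) :
    ∑ r ∈ Finset.Icc 1 p, PermMatrixZ u r (u i) = if i ∈ Finset.Icc 1 p then 1 else 0 := by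
  simp only [PermMatrixZ, u.injective.eq_iff]
  exact Finset.sum_ite_eq' _ _ _

theorem Equiv.Perm.apply_mem_of_fixes_compl {α : Type*} {s : Finset α} {u : Equiv.Perm α}
    (hu : ∀ m, m ∉ s → u m = m) {i : α} (hi : i ∈ s) : u i ∈ s := by
  by_contra h
  exact h ((u.injective (hu _ h)).symm ▸ hi)

/-- For a permutation `u ∈ S_n` and `1 ≤ i < j ≤ n`, the pair `(i,j)` is an
inversion of `u` iff `R_{i,j}^{u(j),u(i)}` is an essential rectangle for the permutation
matrix of `u`. -/
theorem inversion_iff_essRect (n : ℕ) (u : Equiv.Perm ℕ)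
    (hu : ∀ m, m ∉ Finset.Icc 1 n → u m = m)
    (i j : ℕ) (hi : 1 ≤ i) (hij : i < j) (hj : j ≤ n) :
    u j < u i ↔ EssRect n (PermMatrixZ u) i j (u j) (u i) := by
  refine ⟨fun h => ?_, fun h => h.2.2.2.2.1⟩
  have hui := Finset.mem_Icc.1 <|
    Equiv.Perm.apply_mem_of_fixes_compl hu (Finset.mem_Icc.2 ⟨hi, hij.le.trans hj⟩)
  have huj := Finset.mem_Icc.1 <|
    Equiv.Perm.apply_mem_of_fixes_compl hu (Finset.mem_Icc.2 ⟨hi.trans hij.le, hj⟩)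
  refine ⟨hi, hij, hj, huj.1, h, hui.2, fun p q hip hpj hkq hql => ⟨?_, ?_, ?_, ?_⟩⟩
  · rw [cornerSum_col huj.1, sum_col_permMatrixZ, if_neg (by simp; omega), add_zero]
  · rw [cornerSum_col hui.1, sum_col_permMatrixZ, if_pos (by simp; omega)]
  · rw [cornerSum_row hi, sum_row_permMatrixZ, if_neg (by simp; omega), add_zero]
  · rw [cornerSum_row (hi.trans hij.le), sum_row_permMatrixZ, if_pos (by simp; omega)]
end

section
/- Let A be an alternating sign matrix of size n and suppose R_{ij}^{kl} is an essential rectangle for A. Then there exists an alternating sign matrix B of size n whose corner sum matrix satisfies B̃(p,q) = Ã(p,q)+1 for all (p,q) ∈ R_{ij}^{kl} and B̃(p,q) = Ã(p,q) for all other (p,q); i.e. Ã + R̃_{ij}^{kl} is again the corner sum matrix of an ASM, where R̃_{ij}^{kl} is the 0/1 matrix with entry 1 exactly at the positions of R_{ij}^{kl}. -/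
/-- The difference of the indicators of `k` and `l`. -/
def indicatorDiff (k l q : ℕ) : ℤ := (if q = k then 1 else 0) - (if q = l then 1 else 0)

theorem sum_indicatorDiff {k l : ℕ} (hk : 1 ≤ k) (hkl : k < l) (q : ℕ) :
    ∑ t ∈ Finset.Icc 1 q, indicatorDiff k l t = if k ≤ q ∧ q < l then 1 else 0 := by
  simp only [indicatorDiff, Finset.sum_sub_distrib, Finset.sum_ite_eq', Finset.mem_Icc]
  grind

theorem cornerSum_succ_left (A : ℕ → ℕ → ℤ) (p q : ℕ) :
    cornerSum A (p + 1) q = cornerSum A p q + ∑ t ∈ Finset.Icc 1 q, A (p + 1) t :=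
  Finset.sum_Icc_succ_top (by omega) _

theorem cornerSum_succ_right (A : ℕ → ℕ → ℤ) (p q : ℕ) :
    cornerSum A p (q + 1) = cornerSum A p q + ∑ s ∈ Finset.Icc 1 p, A s (q + 1) := by
  simp only [cornerSum, ← Finset.sum_add_distrib]
  exact Finset.sum_congr rfl fun s _ => Finset.sum_Icc_succ_top (by omega) _

theorem sum_row_eq_cornerSum_sub (A : ℕ → ℕ → ℤ) {p : ℕ} (hp : 1 ≤ p) (q : ℕ) :
    ∑ t ∈ Finset.Icc 1 q, A p t = cornerSum A p q - cornerSum A (p - 1) q := by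
  obtain ⟨p, rfl⟩ := Nat.exists_eq_add_of_le' hp
  simp [cornerSum_succ_left]

theorem sum_col_eq_cornerSum_sub (A : ℕ → ℕ → ℤ) (p : ℕ) {q : ℕ} (hq : 1 ≤ q) :
    ∑ s ∈ Finset.Icc 1 p, A s q = cornerSum A p q - cornerSum A p (q - 1) := by
  obtain ⟨q, rfl⟩ := Nat.exists_eq_add_of_le' hq
  simp [cornerSum_succ_right]

/-- A term of a sequence whose partial sums lie in `{0, 1}` lies in `{-1, 0, 1}`. -/
theorem term_mem_of_partialSum_mem {n : ℕ} {a : ℕ → ℤ}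
    (h : ∀ j ∈ Finset.Icc 1 n,
      (∑ k ∈ Finset.Icc 1 j, a k) = 0 ∨ (∑ k ∈ Finset.Icc 1 j, a k) = 1)
    {j : ℕ} (hj : j ∈ Finset.Icc 1 n) : a j = -1 ∨ a j = 0 ∨ a j = 1 := by
  have hj' := Finset.mem_Icc.1 hj
  obtain ⟨m, rfl⟩ := Nat.exists_eq_add_of_le' hj'.1
  have h1 := h _ hj
  rw [Finset.sum_Icc_succ_top (by omega)] at h1
  rcases Nat.eq_zero_or_pos m with rfl | hm
  · simp at h1 ⊢
    omega
  · have h0 := h m (Finset.mem_Icc.2 ⟨hm, by omega⟩)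
    omega

/-- If `R_{ij}^{kl}` is an essential rectangle for an ASM `A`, then
`Ã + R̃_{ij}^{kl}` is again the corner sum matrix of some ASM `B`. -/
theorem exists_asm_of_essRect (n : ℕ) (A : ℕ → ℕ → ℤ) (hA : IsASM n A)
    (i j k l : ℕ) (hR : EssRect n A i j k l) :
    ∃ B : ℕ → ℕ → ℤ, IsASM n B ∧
      (∀ p q, i ≤ p → p < j → k ≤ q → q < l → cornerSum B p q = cornerSum A p q + 1) ∧
      (∀ p q, p ≤ n → q ≤ n → ¬(i ≤ p ∧ p < j ∧ k ≤ q ∧ q < l) →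
        cornerSum B p q = cornerSum A p q) := by
  obtain ⟨-, hrow, hcol, hrow_n, hcol_n⟩ := hA
  obtain ⟨hi, hij, hjn, hk, hkl, hln, hess⟩ := hR
  set B : ℕ → ℕ → ℤ := fun p q => A p q + indicatorDiff i j p * indicatorDiff k l q with hB
  have hBrow (p q : ℕ) : ∑ t ∈ Finset.Icc 1 q, B p t =
      ∑ t ∈ Finset.Icc 1 q, A p t + indicatorDiff i j p * if k ≤ q ∧ q < l then 1 else 0 := by
    simp only [hB, Finset.sum_add_distrib, ← Finset.mul_sum, sum_indicatorDiff hk hkl]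
  have hBcol (p q : ℕ) : ∑ s ∈ Finset.Icc 1 p, B s q =
      ∑ s ∈ Finset.Icc 1 p, A s q + (if i ≤ p ∧ p < j then 1 else 0) * indicatorDiff k l q := by
    simp only [hB, Finset.sum_add_distrib, ← Finset.sum_mul, sum_indicatorDiff hi hij]
  have hBcorner (p q : ℕ) : cornerSum B p q = cornerSum A p q +
      (if i ≤ p ∧ p < j then 1 else 0) * if k ≤ q ∧ q < l then 1 else 0 := by
    simp only [cornerSum, hBrow, Finset.sum_add_distrib, ← Finset.sum_mul,
      sum_indicatorDiff hi hij]
  have hBrow_mem : ∀ p ∈ Finset.Icc 1 n, ∀ q ∈ Finset.Icc 1 n,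
      (∑ t ∈ Finset.Icc 1 q, B p t) = 0 ∨ (∑ t ∈ Finset.Icc 1 q, B p t) = 1 := by
    intro p hp q hq
    have hA' := hrow p hp q hq
    rw [hBrow]
    by_cases hq' : k ≤ q ∧ q < l
    · obtain ⟨-, -, h0, h1⟩ := hess i q le_rfl hij hq'.1 hq'.2
      have hsum := sum_row_eq_cornerSum_sub A (Finset.mem_Icc.1 hp).1 q
      rw [if_pos hq', indicatorDiff]
      by_cases hpi : p = i
      · subst hpi
        rw [if_pos rfl, if_neg hij.ne]
        omega
      · by_cases hpj : p = j
        · subst hpj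
          rw [if_neg hpi, if_pos rfl]
          omega
        · simpa [hpi, hpj] using hA'
    · simpa [hq'] using hA'
  have hBcol_mem : ∀ p ∈ Finset.Icc 1 n, ∀ q ∈ Finset.Icc 1 n,
      (∑ s ∈ Finset.Icc 1 p, B s q) = 0 ∨ (∑ s ∈ Finset.Icc 1 p, B s q) = 1 := by
    intro p hp q hq
    have hA' := hcol p hp q hq
    rw [hBcol]
    by_cases hp' : i ≤ p ∧ p < j
    · obtain ⟨h0, h1, -, -⟩ := hess p k hp'.1 hp'.2 le_rfl hkl
      have hsum := sum_col_eq_cornerSum_sub A p (Finset.mem_Icc.1 hq).1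
      rw [if_pos hp', indicatorDiff]
      by_cases hqk : q = k
      · subst hqk
        rw [if_pos rfl, if_neg hkl.ne]
        omega
      · by_cases hql : q = l
        · subst hql
          rw [if_neg hqk, if_pos rfl]
          omega
        · simpa [hqk, hql] using hA'
    · simpa [hp'] using hA'
  refine ⟨B, ⟨fun p hp q hq => term_mem_of_partialSum_mem (hBrow_mem p hp) hq, hBrow_mem,
    hBcol_mem, fun p hp => ?_, fun q hq => ?_⟩, fun p q h1 h2 h3 h4 => ?_, fun p q _ _ h => ?_⟩
  · rw [hBrow, if_neg (by omega), mul_zero, add_zero, hrow_n p hp]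
  · rw [hBcol, if_neg (by omega), zero_mul, add_zero, hcol_n q hq]
  · rw [hBcorner, if_pos ⟨h1, h2⟩, if_pos ⟨h3, h4⟩, mul_one]
  · rw [hBcorner]
    grind
end

section
/- (Nonpositivity lemma) Let B=(b_{ij}) be an alternating sign matrix of size n and suppose R_{ij}^{kl} is an essential rectangle for B. Then b_{ik} ≤ 0 and b_{jl} ≤ 0. -/
/-- Consecutive entries in a row of the corner sum matrix differ by a partial column sum. -/
theorem cornerSum_eq_add_col (A : ℕ → ℕ → ℤ) (p : ℕ) {q : ℕ} (hq : 1 ≤ q) :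
    cornerSum A p q = cornerSum A p (q - 1) + ∑ r ∈ Finset.Icc 1 p, A r q := by
  obtain ⟨m, rfl⟩ := Nat.exists_eq_add_of_le' hq
  simp [cornerSum, Finset.sum_Icc_succ_top, Finset.sum_add_distrib]

/-- A partial column sum is the previous partial column sum plus the new entry. -/
theorem sum_col_eq_add (A : ℕ → ℕ → ℤ) (q : ℕ) {p : ℕ} (hp : 1 ≤ p) :
    ∑ r ∈ Finset.Icc 1 p, A r q = ∑ r ∈ Finset.Icc 1 (p - 1), A r q + A p q := by
  obtain ⟨m, rfl⟩ := Nat.exists_eq_add_of_le' hp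
  simp [Finset.sum_Icc_succ_top]

theorem IsASM.sum_col_nonneg {n : ℕ} {A : ℕ → ℕ → ℤ} (hA : IsASM n A) {p q : ℕ}
    (hp : p ≤ n) (hq : q ∈ Finset.Icc 1 n) : 0 ≤ ∑ r ∈ Finset.Icc 1 p, A r q := by
  rcases Nat.eq_zero_or_pos p with rfl | h
  · simp
  · rcases hA.2.2.1 p (Finset.mem_Icc.2 ⟨h, hp⟩) q hq with h | h <;> omega

theorem IsASM.sum_col_le_one {n : ℕ} {A : ℕ → ℕ → ℤ} (hA : IsASM n A) {p q : ℕ}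
    (hp : p ≤ n) (hq : q ∈ Finset.Icc 1 n) : ∑ r ∈ Finset.Icc 1 p, A r q ≤ 1 := by
  rcases Nat.eq_zero_or_pos p with rfl | h
  · simp
  · rcases hA.2.2.1 p (Finset.mem_Icc.2 ⟨h, hp⟩) q hq with h | h <;> omega

/-- nonpositivity: if `R_{ij}^{kl}` is an essential rectangle for an ASM `B`,
then `b_{ik} ≤ 0` and `b_{jl} ≤ 0`. -/
theorem essRect_nonpos (n : ℕ) (B : ℕ → ℕ → ℤ) (hB : IsASM n B)
    (i j k l : ℕ) (hR : EssRect n B i j k l) :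
    B i k ≤ 0 ∧ B j l ≤ 0 := by
  obtain ⟨hi, hij, hj, hk, hkl, hl, hcol⟩ := hR
  have hleft := (hcol i k le_rfl hij le_rfl hkl).1
  have hright := (hcol (j - 1) k (by omega) (by omega) le_rfl hkl).2.1
  rw [cornerSum_eq_add_col B _ hk, sum_col_eq_add B k hi] at hleft
  rw [cornerSum_eq_add_col B _ (by omega : 1 ≤ l)] at hright
  have hnonneg := hB.sum_col_nonneg (p := i - 1) (q := k) (by omega)
    (Finset.mem_Icc.2 ⟨hk, by omega⟩)
  have hle := hB.sum_col_le_one hj (Finset.mem_Icc.2 ⟨(by omega : 1 ≤ l), hl⟩)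
  rw [sum_col_eq_add B l (by omega)] at hle
  constructor <;> linarith
end

section
/- (Key Lemma) Let B=(b_{pq}) be an alternating sign matrix of size n, suppose R_{ij}^{kl} is an essential rectangle for B, and let A=(a_{pq}) be an alternating sign matrix of size n. Then the following are equivalent: (1) Ã(p,q) = B̃(p,q)+1 for all (p,q) ∈ R_{ij}^{kl} and Ã(p,q)=B̃(p,q) for all other (p,q) (i.e. A →_{ij}^{kl} B in the ASM graph); (2) a_{ik}−b_{ik}=1, a_{il}−b_{il}=−1, a_{jk}−b_{jk}=−1, a_{jl}−b_{jl}=1, and a_{pq}=b_{pq} for every (p,q) not in {(i,k),(i,l),(j,k),(j,l)}. -/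
theorem cornerSum_succ_succ (A : ℕ → ℕ → ℤ) (p q : ℕ) :
    cornerSum A (p + 1) (q + 1) =
      cornerSum A p (q + 1) + cornerSum A (p + 1) q - cornerSum A p q + A (p + 1) (q + 1) := by
  simp only [cornerSum, Finset.sum_Icc_succ_top (Nat.le_add_left 1 _), Finset.sum_add_distrib]
  ring

theorem cornerSum_zero_left (A : ℕ → ℕ → ℤ) (q : ℕ) : cornerSum A 0 q = 0 := by
  simp [cornerSum]

theorem cornerSum_zero_right (A : ℕ → ℕ → ℤ) (p : ℕ) : cornerSum A p 0 = 0 := by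
  simp [cornerSum]

/-- The indicator function of the rectangle `R_{ij}^{kl}`. -/
def rectIndicator (i j k l p q : ℕ) : ℤ :=
  if i ≤ p ∧ p < j ∧ k ≤ q ∧ q < l then 1 else 0

/-- Two matrices have corner sums differing by `f` iff their entries differ by the mixed
second difference of `f`. -/
theorem cornerSum_eq_add_iff (n : ℕ) (A B f : ℕ → ℕ → ℤ)
    (hleft : ∀ q, f 0 q = 0) (hright : ∀ p, f p 0 = 0) :
    (∀ p q, p ≤ n → q ≤ n → cornerSum A p q = cornerSum B p q + f p q) ↔
      ∀ p q, p < n → q < n → A (p + 1) (q + 1) = B (p + 1) (q + 1) +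
        (f (p + 1) (q + 1) - f p (q + 1) - f (p + 1) q + f p q) := by
  constructor
  · intro h p q hp hq
    have hA := cornerSum_succ_succ A p q
    have hB := cornerSum_succ_succ B p q
    linarith [h p q (by omega) (by omega), h (p + 1) q (by omega) (by omega),
      h p (q + 1) (by omega) (by omega), h (p + 1) (q + 1) (by omega) (by omega)]
  · intro h p
    induction p with
    | zero => intro q _ _; simp [cornerSum_zero_left, hleft]
    | succ p ihp =>
      intro q
      induction q with
      | zero => intro _ _; simp [cornerSum_zero_right, hright]
      | succ q ihq =>
        intro hp hq
        rw [cornerSum_succ_succ A, cornerSum_succ_succ B, h p q (by omega) (by omega),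
          ihp (q + 1) (by omega) hq, ihp q (by omega) (by omega), ihq hp (by omega)]
        ring

/-- Key Lemma: given ASMs `A`, `B` with `R_{ij}^{kl}` essential for `B`,
the corner-sum edge relation `A →_{ij}^{kl} B` holds iff the four entries at
`(i,k), (i,l), (j,k), (j,l)` change by `+1, −1, −1, +1` and all other entries agree. -/
theorem key_lemma (n : ℕ) (A B : ℕ → ℕ → ℤ) (hA : IsASM n A) (hB : IsASM n B)
    (i j k l : ℕ) (hR : EssRect n B i j k l) :
    ((∀ p q, i ≤ p → p < j → k ≤ q → q < l → cornerSum A p q = cornerSum B p q + 1) ∧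
     (∀ p q, p ≤ n → q ≤ n → ¬(i ≤ p ∧ p < j ∧ k ≤ q ∧ q < l) →
        cornerSum A p q = cornerSum B p q)) ↔
    (A i k = B i k + 1 ∧ A i l = B i l - 1 ∧ A j k = B j k - 1 ∧ A j l = B j l + 1 ∧
     ∀ p ∈ Finset.Icc 1 n, ∀ q ∈ Finset.Icc 1 n,
       ¬((p = i ∧ q = k) ∨ (p = i ∧ q = l) ∨ (p = j ∧ q = k) ∨ (p = j ∧ q = l)) →
       A p q = B p q) := by
  obtain ⟨hi, hij, hj, hk, hkl, hl, -⟩ := hR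
  have hcorner := cornerSum_eq_add_iff n A B (rectIndicator i j k l)
    (fun q => if_neg (by omega)) (fun p => if_neg (by omega))
  trans ∀ p q, p ≤ n → q ≤ n → cornerSum A p q = cornerSum B p q + rectIndicator i j k l p q
  · constructor
    · rintro ⟨hin, hout⟩ p q hp hq
      unfold rectIndicator
      split_ifs with h
      · exact hin p q h.1 h.2.1 h.2.2.1 h.2.2.2
      · rw [hout p q hp hq h, add_zero]
    · intro h
      refine ⟨fun p q h1 h2 h3 h4 => ?_, fun p q hp hq hout => ?_⟩
      · rw [h p q (by omega) (by omega), rectIndicator, if_pos ⟨h1, h2, h3, h4⟩]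
      · rw [h p q hp hq, rectIndicator, if_neg hout, add_zero]
  rw [hcorner]
  constructor
  · intro h
    have entry : ∀ p q, 1 ≤ p → p ≤ n → 1 ≤ q → q ≤ n → A p q = B p q +
        (rectIndicator i j k l p q - rectIndicator i j k l (p - 1) q
          - rectIndicator i j k l p (q - 1) + rectIndicator i j k l (p - 1) (q - 1)) := by
      intro p q hp hpn hq hqn
      have := h (p - 1) (q - 1) (by omega) (by omega)
      rwa [Nat.sub_add_cancel hp, Nat.sub_add_cancel hq] at this
    simp only [rectIndicator] at entry
    refine ⟨?_, ?_, ?_, ?_, fun p hp q hq hne => ?_⟩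
    · rw [entry i k (by omega) (by omega) (by omega) (by omega)]
      split_ifs <;> omega
    · rw [entry i l (by omega) (by omega) (by omega) (by omega)]
      split_ifs <;> omega
    · rw [entry j k (by omega) (by omega) (by omega) (by omega)]
      split_ifs <;> omega
    · rw [entry j l (by omega) (by omega) (by omega) (by omega)]
      split_ifs <;> omega
    · rw [Finset.mem_Icc] at hp hq
      rw [entry p q hp.1 hp.2 hq.1 hq.2]
      split_ifs <;> omega
  · rintro ⟨hik, hil, hjk, hjl, hne⟩ p q hp hq
    simp only [rectIndicator]
    by_cases h : (p + 1 = i ∧ q + 1 = k) ∨ (p + 1 = i ∧ q + 1 = l) ∨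
        (p + 1 = j ∧ q + 1 = k) ∨ (p + 1 = j ∧ q + 1 = l)
    · rcases h with ⟨rfl, rfl⟩ | ⟨rfl, rfl⟩ | ⟨rfl, rfl⟩ | ⟨rfl, rfl⟩
      · rw [hik]; split_ifs <;> omega
      · rw [hil]; split_ifs <;> omega
      · rw [hjk]; split_ifs <;> omega
      · rw [hjl]; split_ifs <;> omega
    · rw [hne (p + 1) (Finset.mem_Icc.2 (by omega)) (q + 1) (Finset.mem_Icc.2 (by omega)) h]
      split_ifs <;> omega
end

section
/- For every alternating sign matrix B=(b_{ij}) of size n, 2·β(B) = Σ_{i,j=1}^{n} (i−j)² · b_{ij} (equivalently, β(B) = Σ_{i,j=1}^{n} (i−j)²/2 · b_{ij}). -/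
theorem sum_Icc_sum_Icc_eq (n : ℕ) (f : ℕ → ℤ) :
    ∑ i ∈ Finset.Icc 1 n, ∑ p ∈ Finset.Icc 1 i, f p =
      ∑ p ∈ Finset.Icc 1 n, ((n : ℤ) + 1 - p) * f p := by
  induction n with
  | zero => simp
  | succ n ih =>
    rw [Finset.sum_Icc_succ_top (by omega), ih, Finset.sum_Icc_succ_top (by omega),
      Finset.sum_Icc_succ_top (by omega), ← add_assoc, ← Finset.sum_add_distrib]
    push_cast
    congr 1
    · exact Finset.sum_congr rfl fun p _ => by ring
    · ring

theorem sum_cornerSum_eq (n : ℕ) (A : ℕ → ℕ → ℤ) :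
    ∑ i ∈ Finset.Icc 1 n, ∑ j ∈ Finset.Icc 1 n, cornerSum A i j =
      ∑ p ∈ Finset.Icc 1 n, ∑ q ∈ Finset.Icc 1 n,
        ((n : ℤ) + 1 - p) * ((n : ℤ) + 1 - q) * A p q := by
  have h (i : ℕ) : ∑ j ∈ Finset.Icc 1 n, cornerSum A i j =
      ∑ p ∈ Finset.Icc 1 i, ∑ q ∈ Finset.Icc 1 n, ((n : ℤ) + 1 - q) * A p q := by
    simp only [cornerSum]
    rw [Finset.sum_comm]
    exact Finset.sum_congr rfl fun p _ => sum_Icc_sum_Icc_eq n (A p)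
  simp only [h, sum_Icc_sum_Icc_eq, Finset.mul_sum, mul_assoc]

theorem sum_min_eq (n : ℕ) :
    ∑ i ∈ Finset.Icc 1 n, ∑ j ∈ Finset.Icc 1 n, (min i j : ℤ) =
      ∑ p ∈ Finset.Icc 1 n, ((n : ℤ) + 1 - p) ^ 2 := by
  have hrow (n : ℕ) : ∀ i ∈ Finset.Icc 1 n, (min i (n + 1 : ℕ) : ℤ) = i := by
    intro i hi
    have := (Finset.mem_Icc.mp hi).2
    omega
  induction n with
  | zero => simp
  | succ n ih =>
    have hcol : ∑ j ∈ Finset.Icc 1 n, (min (n + 1 : ℕ) j : ℤ) = ∑ j ∈ Finset.Icc 1 n, (j : ℤ) :=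
      Finset.sum_congr rfl fun j hj => by rw [min_comm, hrow n j hj]
    have hshift : ∑ p ∈ Finset.Icc 1 n, (((n + 1 : ℕ) : ℤ) + 1 - p) ^ 2 =
        ∑ p ∈ Finset.Icc 1 n, ((n : ℤ) + 1 - p) ^ 2 +
          ∑ p ∈ Finset.Icc 1 n, (2 * ((n : ℤ) + 1) + 1 - 2 * p) := by
      rw [← Finset.sum_add_distrib]
      exact Finset.sum_congr rfl fun p _ => by push_cast; ring
    have hgauss : ∀ n : ℕ, 2 * ∑ p ∈ Finset.Icc 1 n, (p : ℤ) = n * (n + 1) := by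
      intro n
      induction n with
      | zero => simp
      | succ n ih =>
        rw [Finset.sum_Icc_succ_top (by omega), mul_add, ih]
        push_cast
        ring
    simp only [Finset.sum_Icc_succ_top (show 1 ≤ n + 1 by omega), Finset.sum_add_distrib]
    rw [ih, Finset.sum_congr rfl (hrow n), hcol, hshift, Finset.sum_sub_distrib,
      ← Finset.mul_sum, hgauss]
    simp only [Finset.sum_const, Nat.card_Icc, nsmul_eq_mul, min_self]
    push_cast
    linarith [hgauss n]

/-- for every ASM `B`, `2·β(B) = Σ_{i,j} (i−j)²·b_{ij}`. -/
theorem two_beta_eq_sum (n : ℕ) (B : ℕ → ℕ → ℤ) (hB : IsASM n B) :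
    2 * asmBeta n B =
      ∑ i ∈ Finset.Icc 1 n, ∑ j ∈ Finset.Icc 1 n, ((i : ℤ) - (j : ℤ)) ^ 2 * B i j := by
  obtain ⟨-, -, -, hrow, hcol⟩ := hB
  have hrows : ∑ i ∈ Finset.Icc 1 n, ∑ j ∈ Finset.Icc 1 n, ((n : ℤ) + 1 - i) ^ 2 * B i j =
      ∑ i ∈ Finset.Icc 1 n, ((n : ℤ) + 1 - i) ^ 2 :=
    Finset.sum_congr rfl fun i hi => by rw [← Finset.mul_sum, hrow i hi, mul_one]
  have hcols : ∑ i ∈ Finset.Icc 1 n, ∑ j ∈ Finset.Icc 1 n, ((n : ℤ) + 1 - j) ^ 2 * B i j =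
      ∑ j ∈ Finset.Icc 1 n, ((n : ℤ) + 1 - j) ^ 2 := by
    rw [Finset.sum_comm]
    exact Finset.sum_congr rfl fun j hj => by rw [← Finset.mul_sum, hcol j hj, mul_one]
  calc 2 * asmBeta n B
      = ∑ i ∈ Finset.Icc 1 n, ∑ j ∈ Finset.Icc 1 n, ((n : ℤ) + 1 - i) ^ 2 * B i j +
          ∑ i ∈ Finset.Icc 1 n, ∑ j ∈ Finset.Icc 1 n, ((n : ℤ) + 1 - j) ^ 2 * B i j -
          2 * ∑ i ∈ Finset.Icc 1 n, ∑ j ∈ Finset.Icc 1 n,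
            ((n : ℤ) + 1 - i) * ((n : ℤ) + 1 - j) * B i j := by
        rw [asmBeta, sum_min_eq, sum_cornerSum_eq, hrows, hcols]
        ring
    _ = _ := by
        simp only [Finset.mul_sum, ← Finset.sum_add_distrib, ← Finset.sum_sub_distrib]
        exact Finset.sum_congr rfl fun i _ => Finset.sum_congr rfl fun j _ => by ring
end

section
/- Let A=(a_{pq}) and B=(b_{pq}) be alternating sign matrices of size n with an ASM graph edge A →_{ij}^{kl} B. Then for every real n×n matrix M=(m_{pq}) all of whose entries are nonzero, Π_{p,q} m_{pq}^{a_{pq}} − Π_{p,q} m_{pq}^{b_{pq}} = (Π_{p,q} m_{pq}^{a_{pq}}) · (m_{ik} m_{jl} − m_{il} m_{jk}) / (m_{ik} m_{jl}). -/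
/-- An entry is the mixed second difference of the corner sum matrix. -/
theorem entry_eq_cornerSum (A : ℕ → ℕ → ℤ) (p q : ℕ) :
    A (p + 1) (q + 1) = cornerSum A (p + 1) (q + 1) - cornerSum A p (q + 1)
      - cornerSum A (p + 1) q + cornerSum A p q := by
  simp only [cornerSum, Finset.sum_Icc_succ_top (Nat.le_add_left 1 _)]
  ring

/-- Along an edge the entries change by `1` at `(i, k)`, `(j, l)` and by `-1` at `(i, l)`,
`(j, k)`. -/
theorem ASMEdge.entry_eq {n : ℕ} {A B : ℕ → ℕ → ℤ} {i j k l : ℕ} (hE : ASMEdge n A B i j k l)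
    {p q : ℕ} (hp : p ∈ Finset.Icc 1 n) (hq : q ∈ Finset.Icc 1 n) :
    A p q = B p q + ((if p = i then 1 else 0) - (if p = j then 1 else 0)) *
      ((if q = k then 1 else 0) - (if q = l then 1 else 0)) := by
  obtain ⟨⟨hi, hij, hj, hk, hkl, hl, -⟩, hin, hout⟩ := hE
  have corner : ∀ p q, p ≤ n → q ≤ n → cornerSum A p q = cornerSum B p q +
      (if i ≤ p ∧ p < j then 1 else 0) * (if k ≤ q ∧ q < l then 1 else 0) := by
    intro p q hp hq
    by_cases h : i ≤ p ∧ p < j ∧ k ≤ q ∧ q < l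
    · rw [hin p q h.1 h.2.1 h.2.2.1 h.2.2.2, if_pos ⟨h.1, h.2.1⟩, if_pos h.2.2, one_mul]
    · rw [hout p q hp hq h]
      grind
  have step : ∀ a b r : ℕ, 1 ≤ a → a < b →
      (if r + 1 = a then 1 else 0) - (if r + 1 = b then 1 else 0) =
        (if a ≤ r + 1 ∧ r + 1 < b then 1 else 0) - (if a ≤ r ∧ r < b then (1 : ℤ) else 0) := by
    intro a b r ha hab
    split_ifs <;> omega
  rw [Finset.mem_Icc] at hp hq
  obtain ⟨p, rfl⟩ := Nat.exists_eq_add_of_le' hp.1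
  obtain ⟨q, rfl⟩ := Nat.exists_eq_add_of_le' hq.1
  rw [entry_eq_cornerSum A, entry_eq_cornerSum B, step i j p hi hij, step k l q hk hkl,
    corner _ _ hp.2 hq.2, corner p _ (by omega) hq.2, corner _ q hp.2 (by omega),
    corner p q (by omega) (by omega)]
  ring

/-- Along an edge the monomial is multiplied by `m_{ik} m_{jl} / (m_{il} m_{jk})`. -/
theorem ASMEdge.asmMon_eq {n : ℕ} {A B : ℕ → ℕ → ℤ} {i j k l : ℕ} (hE : ASMEdge n A B i j k l)
    {M : ℕ → ℕ → ℝ} (hM : ∀ p ∈ Finset.Icc 1 n, ∀ q ∈ Finset.Icc 1 n, M p q ≠ 0) :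
    asmMon n A M = asmMon n B M * (M i k * M j l * (M i l)⁻¹ * (M j k)⁻¹) := by
  obtain ⟨hi, hij, hj, hk, hkl, hl, -⟩ := hE.1
  have entry : ∀ p ∈ Finset.Icc 1 n, ∀ q ∈ Finset.Icc 1 n, M p q ^ A p q = M p q ^ B p q *
      ((if p = i then if q = k then M p q else 1 else 1) *
       (if p = j then if q = l then M p q else 1 else 1) *
       (if p = i then if q = l then (M p q)⁻¹ else 1 else 1) *
       (if p = j then if q = k then (M p q)⁻¹ else 1 else 1)) := by
    intro p hp q hq
    rw [hE.entry_eq hp hq, zpow_add₀ (hM p hp q hq)]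
    congr 1
    split_ifs <;> first | omega | simp
  have corner : ∀ (a b : ℕ) (f : ℕ → ℕ → ℝ), a ∈ Finset.Icc 1 n → b ∈ Finset.Icc 1 n →
      (∏ p ∈ Finset.Icc 1 n, ∏ q ∈ Finset.Icc 1 n,
        if p = a then if q = b then f p q else 1 else 1) = f a b := by
    intro a b f ha hb
    rw [Finset.prod_eq_single_of_mem a ha (fun p _ h => by simp [h]),
      Finset.prod_eq_single_of_mem b hb (fun q _ h => by simp [h])]
    simp
  have hi' : i ∈ Finset.Icc 1 n := Finset.mem_Icc.2 (by omega)
  have hj' : j ∈ Finset.Icc 1 n := Finset.mem_Icc.2 (by omega)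
  have hk' : k ∈ Finset.Icc 1 n := Finset.mem_Icc.2 (by omega)
  have hl' : l ∈ Finset.Icc 1 n := Finset.mem_Icc.2 (by omega)
  unfold asmMon
  rw [Finset.prod_congr rfl fun p hp => Finset.prod_congr rfl (entry p hp)]
  simp only [Finset.prod_mul_distrib]
  rw [corner i k M hi' hk', corner j l M hj' hl', corner i l (fun p q => (M p q)⁻¹) hi' hl',
    corner j k (fun p q => (M p q)⁻¹) hj' hk']

/-- along an edge `A →_{ij}^{kl} B` of the ASM graph, for every real matrix
`M` with nonzero entries,
`x^A(M) − x^B(M) = x^A(M)·(m_{ik} m_{jl} − m_{il} m_{jk})/(m_{ik} m_{jl})`. -/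
theorem mon_diff_of_edge (n : ℕ) (A B : ℕ → ℕ → ℤ) (hA : IsASM n A) (hB : IsASM n B)
    (i j k l : ℕ) (hE : ASMEdge n A B i j k l) (M : ℕ → ℕ → ℝ)
    (hM : ∀ p ∈ Finset.Icc 1 n, ∀ q ∈ Finset.Icc 1 n, M p q ≠ 0) :
    asmMon n A M - asmMon n B M =
      asmMon n A M * (M i k * M j l - M i l * M j k) / (M i k * M j l) := by
  obtain ⟨hi, hij, hj, hk, hkl, hl, -⟩ := hE.1
  have hik := hM i (Finset.mem_Icc.2 (by omega)) k (Finset.mem_Icc.2 (by omega))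
  have hjl := hM j (Finset.mem_Icc.2 (by omega)) l (Finset.mem_Icc.2 (by omega))
  have hil := hM i (Finset.mem_Icc.2 (by omega)) l (Finset.mem_Icc.2 (by omega))
  have hjk := hM j (Finset.mem_Icc.2 (by omega)) k (Finset.mem_Icc.2 (by omega))
  rw [hE.asmMon_eq hM]
  field_simp
end

section
/- Let A and B be alternating sign matrices of size n. If A ≤ B in ASM order, then for every totally nonnegative real n×n matrix M=(m_{ij}) all of whose entries are positive, Π_{i,j} m_{ij}^{a_{ij}} ≥ Π_{i,j} m_{ij}^{b_{ij}}; that is, the ASM Laurent difference x^A − x^B is totally nonnegative. -/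
/-- Abel summation. -/
theorem sum_mul_eq_abel (f g : ℕ → ℝ) (n : ℕ) :
    ∑ q ∈ Finset.Icc 1 n, f q * g q =
      (∑ q ∈ Finset.Icc 1 n, f q) * g (n + 1) +
        ∑ q ∈ Finset.Icc 1 n, (∑ k ∈ Finset.Icc 1 q, f k) * (g q - g (q + 1)) := by
  induction n with
  | zero => simp
  | succ n ih =>
    rw [Finset.sum_Icc_succ_top (by omega), ih, Finset.sum_Icc_succ_top (by omega) (fun q =>
      (∑ k ∈ Finset.Icc 1 q, f k) * (g q - g (q + 1))), Finset.sum_Icc_succ_top (by omega) f]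
    ring

/-- Abel summation in both variables, for an array with vanishing row and column sums. -/
theorem sum_sum_mul_eq_abel (n : ℕ) (D L : ℕ → ℕ → ℝ)
    (hrow : ∀ p ∈ Finset.Icc 1 n, ∑ q ∈ Finset.Icc 1 n, D p q = 0)
    (hcol : ∀ q ∈ Finset.Icc 1 n, ∑ p ∈ Finset.Icc 1 n, D p q = 0) :
    ∑ p ∈ Finset.Icc 1 n, ∑ q ∈ Finset.Icc 1 n, D p q * L p q =
      ∑ q ∈ Finset.Icc 1 n, ∑ p ∈ Finset.Icc 1 n,
        (∑ i ∈ Finset.Icc 1 p, ∑ j ∈ Finset.Icc 1 q, D i j) *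
          ((L p q - L p (q + 1)) - (L (p + 1) q - L (p + 1) (q + 1))) := by
  have h : ∀ p ∈ Finset.Icc 1 n, ∑ q ∈ Finset.Icc 1 n, D p q * L p q =
      ∑ q ∈ Finset.Icc 1 n, (∑ k ∈ Finset.Icc 1 q, D p k) * (L p q - L p (q + 1)) := by
    intro p hp
    rw [sum_mul_eq_abel, hrow p hp, zero_mul, zero_add]
  rw [Finset.sum_congr rfl h, Finset.sum_comm]
  refine Finset.sum_congr rfl fun q hq => ?_
  have hz : ∑ p ∈ Finset.Icc 1 n, ∑ k ∈ Finset.Icc 1 q, D p k = 0 := by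
    rw [Finset.sum_comm]
    refine Finset.sum_eq_zero fun k hk => hcol k ?_
    simp only [Finset.mem_Icc] at hk hq ⊢
    omega
  rw [sum_mul_eq_abel (fun p => ∑ k ∈ Finset.Icc 1 q, D p k) (fun p => L p q - L p (q + 1)),
    hz, zero_mul, zero_add]

/-- The adjacent `2 × 2` minors of a totally nonnegative matrix are nonnegative. -/
theorem IsTNNReal.mul_le_mul_adjacent {n : ℕ} {M : ℕ → ℕ → ℝ} (hM : IsTNNReal n M) {p q : ℕ}
    (hp : 1 ≤ p) (hpn : p < n) (hq : 1 ≤ q) (hqn : q < n) :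
    M p (q + 1) * M (p + 1) q ≤ M p q * M (p + 1) (q + 1) := by
  have h := hM 2 ![p, p + 1] ![q, q + 1]
    (by intro a b hab; fin_cases a <;> fin_cases b <;> simp_all)
    (by intro a b hab; fin_cases a <;> fin_cases b <;> simp_all)
    (by intro a; fin_cases a <;> simp <;> omega)
    (by intro a; fin_cases a <;> simp <;> omega)
  simpa [Matrix.det_fin_two] using h

theorem asmMon_pos {n : ℕ} (A : ℕ → ℕ → ℤ) {M : ℕ → ℕ → ℝ}
    (hpos : ∀ p ∈ Finset.Icc 1 n, ∀ q ∈ Finset.Icc 1 n, 0 < M p q) : 0 < asmMon n A M :=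
  Finset.prod_pos fun p hp => Finset.prod_pos fun q hq => zpow_pos (hpos p hp q hq) _

theorem log_asmMon {n : ℕ} (A : ℕ → ℕ → ℤ) {M : ℕ → ℕ → ℝ}
    (hpos : ∀ p ∈ Finset.Icc 1 n, ∀ q ∈ Finset.Icc 1 n, 0 < M p q) :
    Real.log (asmMon n A M) =
      ∑ p ∈ Finset.Icc 1 n, ∑ q ∈ Finset.Icc 1 n, (A p q : ℝ) * Real.log (M p q) := by
  have h : ∀ p ∈ Finset.Icc 1 n, ∀ q ∈ Finset.Icc 1 n, M p q ^ A p q ≠ 0 :=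
    fun p hp q hq => (zpow_pos (hpos p hp q hq) _).ne'
  rw [asmMon, Real.log_prod fun p hp => Finset.prod_ne_zero_iff.mpr (h p hp)]
  refine Finset.sum_congr rfl fun p hp => ?_
  rw [Real.log_prod (h p hp)]
  exact Finset.sum_congr rfl fun q _ => Real.log_zpow _ _

/-- if `A ≤ B` in ASM order then for every totally nonnegative real matrix
`M` with positive entries, `x^A(M) ≥ x^B(M)`. -/
theorem tnn_of_asmle (n : ℕ) (A B : ℕ → ℕ → ℤ) (hA : IsASM n A) (hB : IsASM n B)
    (hle : ASMLE n A B) (M : ℕ → ℕ → ℝ) (hM : IsTNNReal n M)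
    (hpos : ∀ p ∈ Finset.Icc 1 n, ∀ q ∈ Finset.Icc 1 n, 0 < M p q) :
    asmMon n B M ≤ asmMon n A M := by
  obtain ⟨-, -, -, hAr, hAc⟩ := hA
  obtain ⟨-, -, -, hBr, hBc⟩ := hB
  rw [← Real.log_le_log_iff (asmMon_pos B hpos) (asmMon_pos A hpos), log_asmMon A hpos,
    log_asmMon B hpos, ← sub_nonneg]
  simp only [← Finset.sum_sub_distrib, ← sub_mul]
  have hrow : ∀ p ∈ Finset.Icc 1 n, ∑ q ∈ Finset.Icc 1 n, ((A p q : ℝ) - B p q) = 0 := by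
    intro p hp
    rw [Finset.sum_sub_distrib, sub_eq_zero]
    exact_mod_cast (hAr p hp).trans (hBr p hp).symm
  have hcol : ∀ q ∈ Finset.Icc 1 n, ∑ p ∈ Finset.Icc 1 n, ((A p q : ℝ) - B p q) = 0 := by
    intro q hq
    rw [Finset.sum_sub_distrib, sub_eq_zero]
    exact_mod_cast (hAc q hq).trans (hBc q hq).symm
  rw [sum_sum_mul_eq_abel n (fun p q => (A p q : ℝ) - B p q) (fun p q => Real.log (M p q))
    hrow hcol]
  refine Finset.sum_nonneg fun q hq => Finset.sum_nonneg fun p hp => ?_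
  obtain ⟨hp1, hpn⟩ := Finset.mem_Icc.mp hp
  obtain ⟨hq1, hqn⟩ := Finset.mem_Icc.mp hq
  rcases hqn.eq_or_lt with rfl | hqn
  · rw [Finset.sum_eq_zero fun i hi => hrow i ?_, zero_mul]
    simp only [Finset.mem_Icc] at hi ⊢
    omega
  rcases hpn.eq_or_lt with rfl | hpn
  · rw [Finset.sum_comm, Finset.sum_eq_zero fun i hi => hcol i ?_, zero_mul]
    simp only [Finset.mem_Icc] at hi ⊢
    omega
  refine mul_nonneg ?_ ?_
  · have h := hle p hp q hq
    simp only [cornerSum] at h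
    simp only [Finset.sum_sub_distrib, sub_nonneg]
    exact_mod_cast h
  · have hp' : p + 1 ∈ Finset.Icc 1 n := Finset.mem_Icc.mpr ⟨by omega, hpn⟩
    have hq' : q + 1 ∈ Finset.Icc 1 n := Finset.mem_Icc.mpr ⟨by omega, hqn⟩
    have h := Real.log_le_log (mul_pos (hpos p hp _ hq') (hpos _ hp' q hq))
      (hM.mul_le_mul_adjacent hp1 hpn hq1 hqn)
    rw [Real.log_mul (hpos p hp _ hq').ne' (hpos _ hp' q hq).ne',
      Real.log_mul (hpos p hp q hq).ne' (hpos _ hp' _ hq').ne'] at h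
    linarith
end

section
/- Let A and B be alternating sign matrices of size n and suppose A ≰ B in ASM order, so that Ã(k,l) < B̃(k,l) for some (k,l). Then the real matrix A' defined by a'_{ij} = 2 if i ≤ k and j ≤ l, and a'_{ij} = 1 otherwise, is totally nonnegative with all entries positive, and Π_{i,j} (a'_{ij})^{a_{ij}} − Π_{i,j} (a'_{ij})^{b_{ij}} = 2^{Ã(k,l)} − 2^{B̃(k,l)} < 0. In particular x^A − x^B is not totally nonnegative. -/
/-- Every minor of the matrix equal to `2` on the upper-left `k × l` block and `1` elsewhere is
nonnegative. -/
theorem isTNNReal_upperLeft_two (n k l : ℕ) :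
    IsTNNReal n (fun i j => if i ≤ k ∧ j ≤ l then (2 : ℝ) else 1) := by
  intro r f g hf hg _ _
  have repeated_row (a b : Fin r) (hab : a ≠ b) (h : f a ≤ k ↔ f b ≤ k) :
      (Matrix.of fun a b => if f a ≤ k ∧ g b ≤ l then (2 : ℝ) else 1).det = 0 :=
    Matrix.det_zero_of_row_eq hab (by ext c; simp [h])
  match r with
  | 0 => simp
  | 1 =>
    rw [Matrix.det_fin_one, Matrix.of_apply]
    dsimp only
    split_ifs <;> norm_num
  | 2 =>
    have h₁ : f 0 < f 1 := hf (by decide)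
    have h₂ : g 0 < g 1 := hg (by decide)
    rw [Matrix.det_fin_two]
    simp only [Matrix.of_apply]
    split_ifs <;> first | omega | norm_num
  | r + 3 =>
    have h₂ : 2 % (r + 3) = 2 := Nat.mod_eq_of_lt (by omega)
    refine ge_of_eq ?_
    by_cases h₀₁ : f 0 ≤ k ↔ f 1 ≤ k
    · exact repeated_row 0 1 (by simp) h₀₁
    · by_cases h₁₂ : f 1 ≤ k ↔ f 2 ≤ k
      · exact repeated_row 1 2 (by simp [Fin.ext_iff, h₂]) h₁₂
      · exact repeated_row 0 2 (by simp [Fin.ext_iff, h₂]) (by tauto)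

theorem Finset.filter_Icc_le_of_le {n k : ℕ} (hk : k ≤ n) :
    (Finset.Icc 1 n).filter (· ≤ k) = Finset.Icc 1 k := by
  ext i
  simp only [Finset.mem_filter, Finset.mem_Icc]
  omega

/-- The monomial `x^A` at the matrix equal to `2` on the upper-left `k × l` block and `1` elsewhere
is `2` to the power of the corner sum. -/
theorem asmMon_upperLeft_two {n k l : ℕ} (hk : k ≤ n) (hl : l ≤ n) (A : ℕ → ℕ → ℤ) :
    asmMon n A (fun i j => if i ≤ k ∧ j ≤ l then (2 : ℝ) else 1) =
      (2 : ℝ) ^ cornerSum A k l := by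
  have zpow_sum (s : Finset ℕ) (e : ℕ → ℤ) : (2 : ℝ) ^ ∑ i ∈ s, e i = ∏ i ∈ s, (2 : ℝ) ^ e i := by
    induction s using Finset.induction_on with
    | empty => simp
    | insert a s ha ih => rw [Finset.sum_insert ha, Finset.prod_insert ha, zpow_add₀ two_ne_zero, ih]
  simp only [asmMon, cornerSum, zpow_sum]
  rw [← Finset.filter_Icc_le_of_le hk, ← Finset.filter_Icc_le_of_le hl, Finset.prod_filter]
  refine Finset.prod_congr rfl fun p _ => ?_
  rw [Finset.prod_filter]
  by_cases hp : p ≤ k <;> simp [hp, ite_pow]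

/-- if `Ã(k,l) < B̃(k,l)`, the matrix `A'` (2 on the upper-left `k×l`
block, 1 elsewhere) is TNN with positive entries and witnesses that `x^A − x^B` fails
total nonnegativity: `x^A(A') − x^B(A') = 2^{Ã(k,l)} − 2^{B̃(k,l)} < 0`. -/
theorem not_tnn_of_not_asmle (n : ℕ) (A B : ℕ → ℕ → ℤ) (hA : IsASM n A) (hB : IsASM n B)
    (k l : ℕ) (hk : k ∈ Finset.Icc 1 n) (hl : l ∈ Finset.Icc 1 n)
    (hkl : cornerSum A k l < cornerSum B k l) :
    IsTNNReal n (fun i j => if i ≤ k ∧ j ≤ l then (2 : ℝ) else 1) ∧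
    (∀ p q : ℕ, 0 < (fun i j => if i ≤ k ∧ j ≤ l then (2 : ℝ) else 1) p q) ∧
    asmMon n A (fun i j => if i ≤ k ∧ j ≤ l then (2 : ℝ) else 1) -
        asmMon n B (fun i j => if i ≤ k ∧ j ≤ l then (2 : ℝ) else 1) =
      (2 : ℝ) ^ cornerSum A k l - (2 : ℝ) ^ cornerSum B k l ∧
    asmMon n A (fun i j => if i ≤ k ∧ j ≤ l then (2 : ℝ) else 1) -
        asmMon n B (fun i j => if i ≤ k ∧ j ≤ l then (2 : ℝ) else 1) < 0 := by
  obtain ⟨-, hk⟩ := Finset.mem_Icc.mp hk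
  obtain ⟨-, hl⟩ := Finset.mem_Icc.mp hl
  rw [asmMon_upperLeft_two hk hl, asmMon_upperLeft_two hk hl]
  refine ⟨isTNNReal_upperLeft_two n k l, fun p q => ?_, rfl, ?_⟩
  · dsimp only
    split_ifs <;> norm_num
  · exact sub_neg.mpr (zpow_lt_zpow_right₀ one_lt_two hkl)
end

section
/- (Dodgson's condensation / Desnanot–Jacobi identity, product form) Let A be an n×n matrix over a commutative ring with n ≥ 2, and for index sets let A_j^i denote the submatrix obtained by deleting row i and column j, and A_{1n}^{1n} the submatrix obtained by deleting rows 1 and n and columns 1 and n (the determinant of the empty matrix being 1). Then det(A) · det(A_{1n}^{1n}) = det(A_1^1) · det(A_n^n) − det(A_n^1) · det(A_1^n). -/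
namespace Matrix

variable {m k R : Type*} [Fintype m] [DecidableEq m] [Fintype k] [DecidableEq k] [CommRing R]

theorem det_mul_det_toBlocks₂₂_adjugate (M : Matrix (m ⊕ k) (m ⊕ k) R) :
    M.det * M.adjugate.toBlocks₂₂.det = M.det ^ Fintype.card k * M.toBlocks₁₁.det := by
  have h := M.mul_adjugate
  rw [← fromBlocks_toBlocks M.adjugate] at h
  nth_rewrite 1 [← fromBlocks_toBlocks M] at h
  rw [fromBlocks_multiply, ← fromBlocks_one, fromBlocks_smul, fromBlocks_inj] at h
  obtain ⟨-, h₁₂, -, h₂₂⟩ := h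
  have hmul : M * fromBlocks 1 M.adjugate.toBlocks₁₂ 0 M.adjugate.toBlocks₂₂ =
      fromBlocks M.toBlocks₁₁ 0 M.toBlocks₂₁ (M.det • 1) := by
    nth_rewrite 1 [← fromBlocks_toBlocks M]
    rw [fromBlocks_multiply, h₁₂, h₂₂]
    simp
  have hdet := congrArg det hmul
  rw [det_mul, det_fromBlocks_zero₂₁, det_fromBlocks_zero₁₂, det_one, one_mul, det_smul,
    det_one, mul_one] at hdet
  rw [hdet, mul_comm]

/-- Jacobi's identity for complementary minors of the adjugate. -/
theorem det_toBlocks₂₂_adjugate [Nonempty k] (M : Matrix (m ⊕ k) (m ⊕ k) R) :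
    M.adjugate.toBlocks₂₂.det = M.det ^ (Fintype.card k - 1) * M.toBlocks₁₁.det := by
  let X := mvPolynomialX (m ⊕ k) (m ⊕ k) ℤ
  have hX : X.adjugate.toBlocks₂₂.det = X.det ^ (Fintype.card k - 1) * X.toBlocks₁₁.det := by
    apply mul_left_cancel₀ (det_mvPolynomialX_ne_zero (m ⊕ k) ℤ)
    rw [← mul_assoc, ← pow_succ', Nat.sub_add_cancel Fintype.card_pos]
    exact det_mul_det_toBlocks₂₂_adjugate X
  let f : MvPolynomial ((m ⊕ k) × (m ⊕ k)) ℤ →+* R :=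
    MvPolynomial.eval₂Hom (Int.castRingHom R) fun p => M p.1 p.2
  have hf : f.mapMatrix X = M := by
    ext i j
    simp [f, X]
  have h := congrArg f hX
  rw [map_mul, map_pow, RingHom.map_det, RingHom.map_det, RingHom.map_det, hf] at h
  have hadj : f.mapMatrix X.adjugate.toBlocks₂₂ = M.adjugate.toBlocks₂₂ := by
    rw [← hf, ← RingHom.map_adjugate]
    rfl
  have hblock : f.mapMatrix X.toBlocks₁₁ = M.toBlocks₁₁ := by
    rw [← hf]
    rfl
  rwa [hadj, hblock] at h

end Matrix

/-- The splitting of `Fin (n + 2)` into its interior and its two end points. -/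
noncomputable def finInteriorSumEndsEquiv (n : ℕ) : Fin n ⊕ Fin 2 ≃ Fin (n + 2) :=
  Equiv.ofBijective
    (Sum.elim (fun a : Fin n => a.succ.castSucc) ![0, Fin.last (n + 1)]) <| by
    rw [Fintype.bijective_iff_injective_and_card]
    refine ⟨?_, by simp⟩
    rintro (a | a) (b | b) h
    · simpa using h
    · fin_cases b <;> simp [Fin.ext_iff] at h
      omega
    · fin_cases a <;> simp [Fin.ext_iff] at h
      omega
    · fin_cases a <;> fin_cases b <;> simp [Fin.ext_iff] at h ⊢

/-- Dodgson's condensation / Desnanot–Jacobi, product form: for an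
`(n+2)×(n+2)` matrix over a commutative ring,
`det A · det A_{1n}^{1n} = det A_1^1 · det A_n^n − det A_n^1 · det A_1^n`,
where deleting the first (resp. last) row/column is realized by `Fin.succ`
(resp. `Fin.castSucc`) reindexing. -/
theorem dodgson_condensation {R : Type*} [CommRing R] (n : ℕ)
    (A : Matrix (Fin (n + 2)) (Fin (n + 2)) R) :
    A.det * (A.submatrix (fun a : Fin n => a.succ.castSucc)
        (fun a : Fin n => a.succ.castSucc)).det =
      (A.submatrix (fun a : Fin (n + 1) => a.succ) (fun a : Fin (n + 1) => a.succ)).det *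
        (A.submatrix (fun a : Fin (n + 1) => a.castSucc)
          (fun a : Fin (n + 1) => a.castSucc)).det -
      (A.submatrix (fun a : Fin (n + 1) => a.succ) (fun a : Fin (n + 1) => a.castSucc)).det *
        (A.submatrix (fun a : Fin (n + 1) => a.castSucc)
          (fun a : Fin (n + 1) => a.succ)).det := by
  let e := finInteriorSumEndsEquiv n
  have he₀ : e (Sum.inr 0) = 0 := rfl
  have he₁ : e (Sum.inr 1) = Fin.last (n + 1) := rfl
  have h := (A.submatrix e e).det_toBlocks₂₂_adjugate
  rw [Matrix.adjugate_submatrix_equiv_self, Matrix.det_submatrix_equiv_self,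
    Matrix.det_fin_two] at h
  simp only [Matrix.toBlocks₂₂, Matrix.of_apply, Matrix.submatrix_apply, he₀, he₁,
    Matrix.adjugate_fin_succ_eq_det_submatrix, Fin.succAbove_last, Fin.val_zero, Fin.val_last,
    Fintype.card_fin, Nat.add_one_sub_one, pow_one, zero_add, add_zero, pow_zero, one_mul,
    Fin.succAbove_zero] at h
  have hsign : ((-1 : R) ^ (n + 1)) * (-1) ^ (n + 1) = 1 := by
    rw [← mul_pow]
    simp
  rw [pow_add (-1 : R) (n + 1) (n + 1), hsign, one_mul, mul_mul_mul_comm, hsign, one_mul] at h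
  rw [mul_comm (Matrix.det (A.submatrix Fin.castSucc Fin.succ))] at h
  exact h.symm
end

section
/- (q-analog of Dodgson's condensation) Let n ≥ 2, let q > 0 be a real number, and let A=(a_{ij}) be a real n×n matrix. For an m×m matrix X=(x_{ij}), write X_q for the matrix with entries (X_q)_{ij} = q^{(i−j)²/2} x_{ij} (using the real power, with indices 1..m of X itself). Then det(A_q) · det((A_{1n}^{1n})_q) = det((A_1^1)_q) · det((A_n^n)_q) − q^{n−1} · det((A_n^1)_q) · det((A_1^n)_q), where A_j^i denotes A with row i and column j deleted, and A_{1n}^{1n} denotes A with rows 1,n and columns 1,n deleted (the determinant of the empty matrix being 1). -/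
/-- The q-twist `(X_q)_{ij} = q^{(i−j)²/2}·x_{ij}` of an `m×m` real matrix (indices
re-based at `0`; shifting all indices leaves `(i−j)²` unchanged), using the real power. -/
noncomputable def qTwist (q : ℝ) {m : ℕ} (X : Matrix (Fin m) (Fin m) ℝ) :
    Matrix (Fin m) (Fin m) ℝ :=
  Matrix.of fun i j => q ^ ((((i : ℕ) : ℝ) - ((j : ℕ) : ℝ)) ^ 2 / 2) * X i j

open Matrix in
/-- Jacobi's complementary minor identity, before cancelling powers of the determinant. -/
theorem Matrix.det_mul_det_toBlocks₁₁_adjugate {m n R : Type*} [Fintype m] [Fintype n]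
    [DecidableEq m] [DecidableEq n] [CommRing R] (M : Matrix (m ⊕ n) (m ⊕ n) R) :
    M.det * M.adjugate.toBlocks₁₁.det = M.det ^ Fintype.card m * M.toBlocks₂₂.det := by
  have key : M * fromBlocks M.adjugate.toBlocks₁₁ 0 M.adjugate.toBlocks₂₁ 1 =
      fromBlocks (M.det • 1) M.toBlocks₁₂ 0 M.toBlocks₂₂ := by
    have h := M.mul_adjugate
    generalize M.adjugate = N at h ⊢
    generalize M.det = d at h ⊢
    rw [← M.fromBlocks_toBlocks, ← N.fromBlocks_toBlocks, fromBlocks_multiply,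
      ← fromBlocks_one, fromBlocks_smul, fromBlocks_inj] at h
    nth_rewrite 1 [← M.fromBlocks_toBlocks]
    rw [fromBlocks_multiply, h.1, h.2.2.1]
    simp
  have h := congrArg det key
  rwa [det_mul, det_fromBlocks_zero₁₂, det_fromBlocks_zero₂₁, det_one, mul_one, det_smul,
    det_one, mul_one] at h

/-- The equivalence separating the first and last elements of `Fin (n + 2)` from the others. -/
noncomputable def finTwoSumEquivEnds (n : ℕ) : Fin 2 ⊕ Fin n ≃ Fin (n + 2) :=
  Equiv.ofBijective (Sum.elim ![0, Fin.last (n + 1)] fun a => a.succ.castSucc) <| by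
    rw [Fintype.bijective_iff_injective_and_card]
    refine ⟨?_, by simp [add_comm]⟩
    rintro (a | a) (b | b) h
    · fin_cases a <;> fin_cases b <;> simp_all [Fin.ext_iff]
    · have := b.isLt
      fin_cases a <;> simp [Fin.ext_iff] at h
      omega
    · have := a.isLt
      fin_cases b <;> simp [Fin.ext_iff] at h
      omega
    · simpa [Fin.ext_iff] using h

/-- The Desnanot–Jacobi identity multiplied by the determinant. -/
theorem Matrix.det_mul_desnanot_jacobi {R : Type*} [CommRing R] (n : ℕ)
    (M : Matrix (Fin (n + 2)) (Fin (n + 2)) R) :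
    M.det * ((M.submatrix Fin.succ Fin.succ).det * (M.submatrix Fin.castSucc Fin.castSucc).det -
      (M.submatrix Fin.succ Fin.castSucc).det * (M.submatrix Fin.castSucc Fin.succ).det) =
    M.det * (M.det * (M.submatrix (fun a : Fin n => a.succ.castSucc)
      (fun a : Fin n => a.succ.castSucc)).det) := by
  have h := (M.submatrix (finTwoSumEquivEnds n)
    (finTwoSumEquivEnds n)).det_mul_det_toBlocks₁₁_adjugate
  have e0 : finTwoSumEquivEnds n (Sum.inl 0) = 0 := rfl
  have e1 : finTwoSumEquivEnds n (Sum.inl 1) = Fin.last (n + 1) := rfl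
  have e2 : (M.submatrix (finTwoSumEquivEnds n) (finTwoSumEquivEnds n)).toBlocks₂₂ =
      M.submatrix (fun a : Fin n => a.succ.castSucc) (fun a : Fin n => a.succ.castSucc) := rfl
  have hsign : (-1 : R) ^ (n + 1) * (-1) ^ (n + 1) = 1 := by
    rw [← mul_pow]; simp
  rw [det_submatrix_equiv_self, adjugate_submatrix_equiv_self, e2, det_fin_two] at h
  simp only [toBlocks₁₁, of_apply, submatrix_apply, e0, e1, adjugate_fin_succ_eq_det_submatrix,
    Fin.succAbove_last, Fin.succAbove_zero, Fin.val_last, Fin.val_zero, pow_add _ (n + 1) (n + 1),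
    hsign, Fintype.card_fin, add_zero, zero_add, pow_zero, one_mul] at h
  linear_combination h + M.det * (M.submatrix Fin.succ Fin.castSucc).det *
    (M.submatrix Fin.castSucc Fin.succ).det * hsign

/-- The **Desnanot–Jacobi identity** (Dodgson condensation). -/
theorem Matrix.desnanot_jacobi {R : Type*} [CommRing R] (n : ℕ)
    (M : Matrix (Fin (n + 2)) (Fin (n + 2)) R) :
    M.det * (M.submatrix (fun a : Fin n => a.succ.castSucc)
      (fun a : Fin n => a.succ.castSucc)).det =
    (M.submatrix Fin.succ Fin.succ).det * (M.submatrix Fin.castSucc Fin.castSucc).det -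
      (M.submatrix Fin.succ Fin.castSucc).det * (M.submatrix Fin.castSucc Fin.succ).det := by
  have h := mul_left_cancel₀ (det_mvPolynomialX_ne_zero (Fin (n + 2)) ℤ)
    (det_mul_desnanot_jacobi n (mvPolynomialX (Fin (n + 2)) (Fin (n + 2)) ℤ))
  have h' := congrArg (MvPolynomial.eval₂Hom (Int.castRingHom R)
    fun p : Fin (n + 2) × Fin (n + 2) => M p.1 p.2) h
  have hM : (mvPolynomialX (Fin (n + 2)) (Fin (n + 2)) ℤ).map
      (MvPolynomial.eval₂Hom (Int.castRingHom R)
        fun p : Fin (n + 2) × Fin (n + 2) => M p.1 p.2) = M :=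
    mvPolynomialX_map_eval₂ _ _
  simp only [map_sub, map_mul, RingHom.map_det, RingHom.mapMatrix_apply, ← submatrix_map, hM] at h'
  exact h'.symm

/-- Scaling entry `(i, j)` by `c * (r i / r j)` scales the determinant by `c ^ m`. -/
theorem Matrix.det_of_mul_div {K : Type*} [Field K] {m : ℕ} (c : K) (r : Fin m → K)
    (hr : ∀ i, r i ≠ 0) (X : Matrix (Fin m) (Fin m) K) :
    (of fun i j => c * (r i / r j) * X i j).det = c ^ m * X.det := by
  have h : (of fun i j => c * (r i / r j) * X i j) =
      c • (diagonal r * X * diagonal fun j => (r j)⁻¹) := by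
    ext i j
    simp only [of_apply, smul_apply, mul_diagonal, diagonal_mul, smul_eq_mul]
    ring
  have hprod : (∏ i, r i) ≠ 0 := Finset.prod_ne_zero_iff.mpr fun i _ => hr i
  rw [h, det_smul, det_mul, det_mul, det_diagonal, det_diagonal, Finset.prod_inv_distrib,
    Fintype.card_fin]
  field_simp

theorem det_qTwist_submatrix_succ_castSucc (q : ℝ) (hq : 0 < q) (n : ℕ)
    (A : Matrix (Fin (n + 1)) (Fin (n + 1)) ℝ) :
    ((qTwist q A).submatrix Fin.succ Fin.castSucc).det =
      (q ^ (1 / 2 : ℝ)) ^ n * (qTwist q (A.submatrix Fin.succ Fin.castSucc)).det := by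
  rw [← Matrix.det_of_mul_div _ (fun i : Fin n => q ^ ((i : ℕ) : ℝ))
    fun i => (Real.rpow_pos_of_pos hq _).ne']
  congr 1
  ext i j
  simp only [qTwist, Matrix.submatrix_apply, Matrix.of_apply, Fin.val_succ, Fin.val_castSucc]
  rw [← Real.rpow_sub hq, ← Real.rpow_add hq, ← mul_assoc, ← Real.rpow_add hq]
  congr 2
  push_cast
  ring

theorem qTwist_transpose (q : ℝ) {m : ℕ} (X : Matrix (Fin m) (Fin m) ℝ) :
    qTwist q X.transpose = (qTwist q X).transpose := by
  ext i j
  simp only [qTwist, Matrix.transpose_apply, Matrix.of_apply]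
  rw [← neg_sub, neg_sq]

theorem det_qTwist_submatrix_castSucc_succ (q : ℝ) (hq : 0 < q) (n : ℕ)
    (A : Matrix (Fin (n + 1)) (Fin (n + 1)) ℝ) :
    ((qTwist q A).submatrix Fin.castSucc Fin.succ).det =
      (q ^ (1 / 2 : ℝ)) ^ n * (qTwist q (A.submatrix Fin.castSucc Fin.succ)).det := by
  have h := det_qTwist_submatrix_succ_castSucc q hq n A.transpose
  rwa [qTwist_transpose, ← Matrix.transpose_submatrix, ← Matrix.transpose_submatrix,
    qTwist_transpose, Matrix.det_transpose, Matrix.det_transpose] at h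

/-- q-analog of Dodgson's condensation: for a real `(n+2)×(n+2)` matrix `A`
and `q > 0`,
`det(A_q)·det((A_{1n}^{1n})_q) = det((A_1^1)_q)·det((A_n^n)_q) − q^{(n+2)−1}·det((A_n^1)_q)·det((A_1^n)_q)`,
where each submatrix is re-indexed `0..m-1` before applying the q-twist
`(X_q)_{ij} = q^{(i−j)²/2}·x_{ij}` (real power). -/
theorem q_dodgson_condensation (n : ℕ) (q : ℝ) (hq : 0 < q)
    (A : Matrix (Fin (n + 2)) (Fin (n + 2)) ℝ) :
    (qTwist q A).det *
        (qTwist q (A.submatrix (fun a : Fin n => a.succ.castSucc)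
          (fun a : Fin n => a.succ.castSucc))).det =
      (qTwist q (A.submatrix (fun a : Fin (n + 1) => a.succ)
          (fun a : Fin (n + 1) => a.succ))).det *
        (qTwist q (A.submatrix (fun a : Fin (n + 1) => a.castSucc)
          (fun a : Fin (n + 1) => a.castSucc))).det -
      q ^ (n + 1) *
        ((qTwist q (A.submatrix (fun a : Fin (n + 1) => a.succ)
            (fun a : Fin (n + 1) => a.castSucc))).det *
          (qTwist q (A.submatrix (fun a : Fin (n + 1) => a.castSucc)
            (fun a : Fin (n + 1) => a.succ))).det) := by
  have h := Matrix.desnanot_jacobi n (qTwist q A)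
  rw [det_qTwist_submatrix_succ_castSucc q hq, det_qTwist_submatrix_castSucc_succ q hq] at h
  have hmid : (qTwist q A).submatrix (fun a : Fin n => a.succ.castSucc)
      (fun a : Fin n => a.succ.castSucc) =
      qTwist q (A.submatrix (fun a : Fin n => a.succ.castSucc)
        (fun a : Fin n => a.succ.castSucc)) := by
    ext i j
    simp [qTwist]
  have hsucc : (qTwist q A).submatrix Fin.succ Fin.succ =
      qTwist q (A.submatrix Fin.succ Fin.succ) := by
    ext i j
    simp [qTwist]
  have hcast : (qTwist q A).submatrix Fin.castSucc Fin.castSucc =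
      qTwist q (A.submatrix Fin.castSucc Fin.castSucc) := rfl
  have hpow : (q ^ (1 / 2 : ℝ)) ^ (n + 1) * (q ^ (1 / 2 : ℝ)) ^ (n + 1) = q ^ (n + 1) := by
    rw [← mul_pow, ← Real.rpow_add hq]
    norm_num
  rw [hmid, hsucc, hcast] at h
  rw [h, ← hpow]
  ring
end

section
/- (Signed bigrassmannian polynomial: recursion) For n ≥ 3 and every real number q, B_n(q) · B_{n−2}(q) = B_{n−1}(q)² · (1 − q^{n−1}), where B_m(q) = Σ_{w ∈ S_m} (−1)^{ℓ(w)} q^{β(w)} with ℓ(w) the inversion number of w and β(w) = (1/2)·Σ_{i=1}^{m} (i − w(i))² (a nonnegative integer). -/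
/-- The inversion number `ℓ(w)` of a permutation of `Fin m`. -/
def invNum {m : ℕ} (w : Equiv.Perm (Fin m)) : ℕ :=
  (Finset.univ.filter (fun p : Fin m × Fin m => p.1 < p.2 ∧ w p.2 < w p.1)).card

/-- The bigrassmannian statistic `β(w) = (1/2)·Σ_i (i − w(i))²`, a nonnegative integer. -/
def betaPerm {m : ℕ} (w : Equiv.Perm (Fin m)) : ℕ :=
  ((∑ i : Fin m, (((i : ℕ) : ℤ) - ((w i : ℕ) : ℤ)) ^ 2) / 2).toNat

/-- The signed bigrassmannian polynomial `B_m(q) = Σ_{w ∈ S_m} (−1)^{ℓ(w)} q^{β(w)}`. -/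
noncomputable def signedBig (m : ℕ) (q : ℝ) : ℝ :=
  ∑ w : Equiv.Perm (Fin m), (-1 : ℝ) ^ invNum w * q ^ betaPerm w

theorem sign_eq_neg_one_pow_invNum {m : ℕ} (w : Equiv.Perm (Fin m)) :
    ((Equiv.Perm.sign w : ℤ) : ℝ) = (-1) ^ invNum w := by
  have hcard : invNum w = ∑ j : Fin m, ((Finset.Iio j).filter fun i => w j < w i).card := by
    rw [invNum, Finset.card_filter, Fintype.sum_prod_type_right]
    refine Finset.sum_congr rfl fun j _ => ?_
    rw [← Finset.card_filter]
    congr 1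
    ext i
    simp
  have hsign : Equiv.Perm.sign w = (-1) ^ invNum w := by
    rw [w.sign_eq_prod_prod_Iio, hcard, ← Finset.prod_pow_eq_pow_sum]
    refine Finset.prod_congr rfl fun j _ => ?_
    rw [← Finset.prod_const, Finset.prod_filter]
    refine Finset.prod_congr rfl fun i hi => ?_
    have hne : w i ≠ w j := w.injective.ne (Finset.mem_Iio.1 hi).ne
    rcases lt_or_gt_of_ne hne with h | h
    · simp [h, h.not_gt]
    · simp [h, h.not_gt]
  simp [hsign]

theorem betaPerm_add_sum {m : ℕ} (w : Equiv.Perm (Fin m)) :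
    betaPerm w + ∑ i : Fin m, (w i : ℕ) * (i : ℕ) = ∑ i : Fin m, (i : ℕ) * (i : ℕ) := by
  have hperm : ∑ i : Fin m, ((w i : ℕ) : ℤ) ^ 2 = ∑ i : Fin m, ((i : ℕ) : ℤ) ^ 2 :=
    Equiv.sum_comp w fun i => ((i : ℕ) : ℤ) ^ 2
  have hsum : ∑ i : Fin m, (((i : ℕ) : ℤ) - ((w i : ℕ) : ℤ)) ^ 2 =
      2 * (∑ i : Fin m, ((i : ℕ) : ℤ) ^ 2 - ∑ i : Fin m, ((w i : ℕ) : ℤ) * ((i : ℕ) : ℤ)) := by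
    have hexp (i : Fin m) : (((i : ℕ) : ℤ) - ((w i : ℕ) : ℤ)) ^ 2 =
        ((i : ℕ) : ℤ) ^ 2 + ((w i : ℕ) : ℤ) ^ 2 - 2 * (((w i : ℕ) : ℤ) * ((i : ℕ) : ℤ)) := by
      ring
    simp_rw [hexp]
    rw [Finset.sum_sub_distrib, Finset.sum_add_distrib, ← Finset.mul_sum, hperm]
    ring
  have hnonneg : 0 ≤ ∑ i : Fin m, (((i : ℕ) : ℤ) - ((w i : ℕ) : ℤ)) ^ 2 :=
    Finset.sum_nonneg fun i _ => sq_nonneg _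
  have hbeta : (betaPerm w : ℤ) =
      ∑ i : Fin m, ((i : ℕ) : ℤ) ^ 2 - ∑ i : Fin m, ((w i : ℕ) : ℤ) * ((i : ℕ) : ℤ) := by
    rw [betaPerm]
    omega
  zify
  rw [hbeta]
  simp_rw [sq]
  ring

theorem signedBig_eq_det_vandermonde (m : ℕ) {q : ℝ} (hq : q ≠ 0) :
    signedBig m q = q ^ (∑ i : Fin m, (i : ℕ) * (i : ℕ)) *
      (Matrix.vandermonde fun i : Fin m => q⁻¹ ^ (i : ℕ)).det := by
  rw [signedBig, Matrix.det_apply', Finset.mul_sum]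
  refine Finset.sum_congr rfl fun w _ => ?_
  rw [sign_eq_neg_one_pow_invNum, ← betaPerm_add_sum w]
  simp_rw [Matrix.vandermonde_apply, ← pow_mul]
  rw [Finset.prod_pow_eq_pow_sum, pow_add, inv_pow]
  field_simp

theorem signedBig_eq_prod_of_ne_zero (m : ℕ) {q : ℝ} (hq : q ≠ 0) :
    signedBig m q = ∏ j ∈ Finset.range m, ∏ k ∈ Finset.range j, (1 - q ^ (k + 1)) := by
  rw [signedBig_eq_det_vandermonde m hq, Matrix.det_vandermonde,
    Finset.prod_comm' (t' := Finset.univ) (s' := fun j => Finset.Iio j) (by simp),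
    ← Finset.prod_pow_eq_pow_sum, ← Finset.prod_mul_distrib,
    ← Fin.prod_univ_eq_prod_range (fun j => ∏ k ∈ Finset.range j, (1 - q ^ (k + 1)))]
  refine Finset.prod_congr rfl fun j _ => ?_
  have hIio : ∏ i ∈ Finset.Iio j, (q⁻¹ ^ (j : ℕ) - q⁻¹ ^ (i : ℕ)) =
      ∏ i ∈ Finset.range (j : ℕ), (q⁻¹ ^ (j : ℕ) - q⁻¹ ^ i) := by
    rw [← Nat.Iio_eq_range, ← Fin.map_valEmbedding_Iio, Finset.prod_map]
    rfl
  have hpow : q ^ ((j : ℕ) * (j : ℕ)) = ∏ _i ∈ Finset.range (j : ℕ), q ^ (j : ℕ) := by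
    rw [Finset.prod_const, Finset.card_range, pow_mul]
  rw [hIio, hpow, ← Finset.prod_mul_distrib, ← Finset.prod_range_reflect]
  refine Finset.prod_congr rfl fun k hk => ?_
  obtain ⟨d, hd⟩ := Nat.exists_eq_add_of_lt (Finset.mem_range.1 hk)
  have hidx : (j : ℕ) - 1 - k = d := by omega
  rw [hidx, hd, inv_pow, inv_pow, mul_sub, mul_inv_cancel₀ (pow_ne_zero _ hq),
    show k + d + 1 = (k + 1) + d by ring, pow_add, mul_assoc,
    mul_inv_cancel₀ (pow_ne_zero _ hq), mul_one]

theorem signedBig_eq_prod (m : ℕ) (q : ℝ) :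
    signedBig m q = ∏ j ∈ Finset.range m, ∏ k ∈ Finset.range j, (1 - q ^ (k + 1)) := by
  have hcont : Continuous (signedBig m) := by
    unfold signedBig
    fun_prop
  exact congrFun (hcont.ext_on (dense_compl_singleton (0 : ℝ)) (by fun_prop)
    fun x hx => signedBig_eq_prod_of_ne_zero m hx) q

/-- signed bigrassmannian polynomial, recursion: for `n ≥ 3`,
`B_n(q)·B_{n−2}(q) = B_{n−1}(q)²·(1 − q^{n−1})`. -/
theorem signedBig_recursion (n : ℕ) (hn : 3 ≤ n) (q : ℝ) :
    signedBig n q * signedBig (n - 2) q =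
      (signedBig (n - 1) q) ^ 2 * (1 - q ^ (n - 1)) := by
  obtain ⟨k, rfl⟩ : ∃ k, n = k + 2 := ⟨n - 2, by omega⟩
  simp only [signedBig_eq_prod, Nat.add_sub_cancel, show k + 2 - 1 = k + 1 from rfl]
  rw [Finset.prod_range_succ, Finset.prod_range_succ, Finset.prod_range_succ _ k]
  ring
end

section
/- (Signed bigrassmannian statistics product formula) For every n ≥ 1 and every real number q, Σ_{w ∈ S_n} (−1)^{ℓ(w)} q^{β(w)} = Π_{k=1}^{n−1} (1 − q^k)^{n−k}, where ℓ(w) is the inversion number of w and β(w) = (1/2)·Σ_{i=1}^{n} (i − w(i))² (a nonnegative integer). -/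
open Finset in
theorem neg_one_pow_invNum {m : ℕ} (w : Equiv.Perm (Fin m)) :
    (-1 : ℤˣ) ^ invNum w = Equiv.Perm.sign w := by
  have h : univ.filter (fun p : Fin m × Fin m => p.1 < p.2 ∧ w p.2 < w p.1) =
      (univ.filter fun p : Fin m × Fin m => p.1 < p.2).filter fun p => w p.2 < w p.1 := by
    rw [filter_filter]
  rw [Equiv.Perm.sign_eq_prod_prod_Ioi, invNum, h, ← prod_const, prod_filter, prod_filter,
    ← univ_product_univ, prod_product]
  refine prod_congr rfl fun i _ => ?_
  rw [← prod_filter, filter_lt_eq_Ioi]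
  refine prod_congr rfl fun j hj => ?_
  have hne : w i ≠ w j := w.injective.ne (mem_Ioi.1 hj).ne
  rcases lt_or_gt_of_ne hne with h | h
  · simp [h, h.not_gt]
  · simp [h, h.not_gt]

theorem betaPerm_add_sum_mul {m : ℕ} (w : Equiv.Perm (Fin m)) :
    betaPerm w + ∑ i, (w i : ℕ) * (i : ℕ) = ∑ i : Fin m, (i : ℕ) * (i : ℕ) := by
  have hw : ∑ i, ((w i : ℕ) : ℤ) * ((w i : ℕ) : ℤ) = ∑ i : Fin m, ((i : ℕ) : ℤ) * ((i : ℕ) : ℤ) :=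
    Equiv.sum_comp w fun i : Fin m => ((i : ℕ) : ℤ) * ((i : ℕ) : ℤ)
  have h : ∑ i : Fin m, (((i : ℕ) : ℤ) - ((w i : ℕ) : ℤ)) ^ 2 =
      2 * (∑ i : Fin m, ((i : ℕ) : ℤ) * ((i : ℕ) : ℤ) - ∑ i, ((w i : ℕ) : ℤ) * ((i : ℕ) : ℤ)) := by
    calc _ = ∑ i : Fin m, ((i : ℕ) : ℤ) * ((i : ℕ) : ℤ) + ∑ i, ((w i : ℕ) : ℤ) * ((w i : ℕ) : ℤ) -
          2 * ∑ i, ((w i : ℕ) : ℤ) * ((i : ℕ) : ℤ) := by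
          rw [Finset.mul_sum, ← Finset.sum_add_distrib, ← Finset.sum_sub_distrib]
          exact Finset.sum_congr rfl fun i _ => by ring
      _ = _ := by rw [hw]; ring
  have h0 : 0 ≤ ∑ i : Fin m, (((i : ℕ) : ℤ) - ((w i : ℕ) : ℤ)) ^ 2 :=
    Finset.sum_nonneg fun i _ => sq_nonneg _
  zify
  rw [betaPerm]
  omega

open Finset in
theorem prod_pow_mul_self_eq_prod_prod_Ioi {R : Type*} [CommMonoid R] (m : ℕ) (q : R) :
    ∏ i : Fin m, q ^ ((i : ℕ) * (i : ℕ)) = ∏ i : Fin m, ∏ j ∈ Ioi i, q ^ (j : ℕ) := by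
  rw [prod_comm' (t' := univ) (s' := fun j => Iio j) (by simp)]
  simp [pow_mul]

open Finset in
theorem prod_prod_Ioi_one_sub_pow {R : Type*} [CommRing R] (m : ℕ) (q : R) :
    ∏ i : Fin m, ∏ j ∈ Ioi i, (1 - q ^ ((j : ℕ) - (i : ℕ))) =
      ∏ k ∈ Icc 1 (m - 1), (1 - q ^ k) ^ (m - k) := by
  have h : ∀ m : ℕ, ∏ i : Fin m, ∏ j ∈ Ioi i, (1 - q ^ ((j : ℕ) - (i : ℕ))) =
      ∏ k ∈ range m, (1 - q ^ (k + 1)) ^ (m - (k + 1)) := by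
    intro m
    induction m with
    | zero => simp
    | succ m ih =>
      rw [Fin.prod_univ_succ, Fin.prod_Ioi_zero]
      simp only [Fin.prod_Ioi_succ, Fin.val_succ, Nat.add_sub_add_right, Fin.val_zero,
        Nat.sub_zero, ih]
      rw [Fin.prod_univ_eq_prod_range (fun k => 1 - q ^ (k + 1)) m, ← prod_mul_distrib,
        prod_range_succ _ m]
      simp only [Nat.sub_self, pow_zero, mul_one]
      refine prod_congr rfl fun k hk => ?_
      rw [← pow_succ']
      congr 1
      have := mem_range.1 hk
      omega
  have hIcc : Icc 1 (m - 1) = Ico 1 m := by ext; simp; omega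
  rw [h, hIcc, prod_Ico_eq_prod_range]
  cases m with
  | zero => simp
  | succ m =>
    rw [prod_range_succ]
    simp [add_comm]

open Finset in
theorem signedBig_eq_prod_prod_Ioi_of_ne_zero (m : ℕ) {q : ℝ} (hq : q ≠ 0) :
    signedBig m q = ∏ i : Fin m, ∏ j ∈ Ioi i, (1 - q ^ ((j : ℕ) - (i : ℕ))) := by
  have hdet : signedBig m q = (∏ i : Fin m, q ^ ((i : ℕ) * (i : ℕ))) *
      (Matrix.vandermonde fun i : Fin m => q⁻¹ ^ (i : ℕ)).det := by
    rw [Matrix.det_apply', mul_sum, signedBig]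
    refine sum_congr rfl fun w _ => ?_
    have hs : ((Equiv.Perm.sign w : ℤ) : ℝ) = (-1) ^ invNum w := by
      rw [← neg_one_pow_invNum]; simp
    simp only [Matrix.vandermonde_apply, ← pow_mul, prod_pow_eq_pow_sum, hs]
    rw [← betaPerm_add_sum_mul w, pow_add, inv_pow]
    field_simp
  rw [hdet, Matrix.det_vandermonde, prod_pow_mul_self_eq_prod_prod_Ioi, ← prod_mul_distrib]
  refine prod_congr rfl fun i _ => ?_
  rw [← prod_mul_distrib]
  refine prod_congr rfl fun j hj => ?_
  have hij : (i : ℕ) ≤ j := (Fin.lt_def.1 (mem_Ioi.1 hj)).le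
  rw [pow_sub₀ q hq hij, mul_sub, inv_pow, inv_pow, mul_inv_cancel₀ (pow_ne_zero _ hq)]

theorem continuous_signedBig (m : ℕ) : Continuous (signedBig m) := by
  unfold signedBig
  fun_prop

/-- signed bigrassmannian statistics, product formula: for `n ≥ 1`,
`Σ_{w ∈ S_n} (−1)^{ℓ(w)} q^{β(w)} = Π_{k=1}^{n−1} (1 − q^k)^{n−k}`. -/
theorem signedBig_product_formula (n : ℕ) (hn : 1 ≤ n) (q : ℝ) :
    signedBig n q = ∏ k ∈ Finset.Icc 1 (n - 1), (1 - q ^ k) ^ (n - k) := by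
  refine congrFun (Continuous.ext_on (dense_compl_singleton (0 : ℝ)) (continuous_signedBig n)
    (g := fun q => ∏ k ∈ Finset.Icc 1 (n - 1), (1 - q ^ k) ^ (n - k)) (by fun_prop)
    fun x hx => ?_) q
  rw [signedBig_eq_prod_prod_Ioi_of_ne_zero n hx, prod_prod_Ioi_one_sub_pow]
end
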